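/- If n ≥ 2 is an integer, A ≥ C ≥ 0 are real numbers, and B_λ is a real number, then √(B_λ² + C²/n) ≤ √(n−2)·(A − C) + √(B_λ² + ((n−1)·C − (n−2)·A)²/(n−1)). -/

import Mathlib

/-- If `n ≥ 2` is an integer, `A ≥ C ≥ 0` are real numbers, and `Bλ` is a real number, then
`√(Bλ² + C²/n) ≤ √(n−2)·(A − C) + √(Bλ² + ((n−1)·C − (n−2)·A)²/(n−1))`. -/
theorem sqrt_ineq_per_contract (n : ℤ) (hn : 2 ≤ n) (A C Bl : ℝ) (hAC : A ≥ C) (hC : C ≥ 0) :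
    Real.sqrt (Bl ^ 2 + C ^ 2 / (n : ℝ)) ≤
      Real.sqrt ((n : ℝ) - 2) * (A - C)
        + Real.sqrt (Bl ^ 2 + (((n : ℝ) - 1) * C - ((n : ℝ) - 2) * A) ^ 2 / ((n : ℝ) - 1)) := by
  have hn' : (2 : ℝ) ≤ (n : ℝ) := by exact_mod_cast hn
  obtain ⟨m, hm⟩ : ∃ m : ℝ, m = (n : ℝ) - 2 := ⟨_, rfl⟩
  obtain ⟨D, hD⟩ : ∃ D : ℝ, D = A - C := ⟨_, rfl⟩
  have hm0 : 0 ≤ m := by linarith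
  have hD0 : 0 ≤ D := by linarith
  have e1 : (n : ℝ) = m + 2 := by linarith
  have e2 : A = C + D := by linarith
  rw [e1, e2]
  have f1 : m + 2 - 2 = m := by ring
  have f2 : m + 2 - 1 = m + 1 := by ring
  have f3 : C + D - C = D := by ring
  have f4 : (m + 1) * C - m * (C + D) = C - m * D := by ring
  rw [f1, f2, f3, f4]
  have hp : 0 < Real.sqrt (m + 1) := Real.sqrt_pos.mpr (by linarith)
  have hp2 : Real.sqrt (m + 1) ^ 2 = m + 1 := Real.sq_sqrt (by linarith)
  have hs : 0 ≤ Real.sqrt m := Real.sqrt_nonneg _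
  have hs2 : Real.sqrt m ^ 2 = m := Real.sq_sqrt hm0
  have hsp : Real.sqrt m ≤ Real.sqrt (m + 1) := Real.sqrt_le_sqrt (by linarith)
  set p := Real.sqrt (m + 1)
  set s := Real.sqrt m
  have hY : 0 ≤ Bl ^ 2 + (C - m * D) ^ 2 / (m + 1) := by positivity
  have hT2 := Real.sq_sqrt hY
  have hT := Real.sqrt_nonneg (Bl ^ 2 + (C - m * D) ^ 2 / (m + 1))
  set T := Real.sqrt (Bl ^ 2 + (C - m * D) ^ 2 / (m + 1))
  obtain ⟨u, hu⟩ : ∃ u : ℝ, u = (C - m * D) / p := ⟨_, rfl⟩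
  obtain ⟨v, hv⟩ : ∃ v : ℝ, v = m * D / p := ⟨_, rfl⟩
  have hv0 : 0 ≤ v := by rw [hv]; positivity
  have hu2 : u ^ 2 = (C - m * D) ^ 2 / (m + 1) := by rw [hu, div_pow, hp2]
  have huv : (u + v) ^ 2 = C ^ 2 / (m + 1) := by
    rw [hu, hv, ← add_div, div_pow, hp2]; congr 2; ring
  have hvs : v ≤ s * D := by
    rw [hv, div_le_iff₀ hp]
    have : m ≤ s * p := by nlinarith
    nlinarith
  have huT : u ≤ T := by
    exact le_trans (le_abs_self u) (abs_le_of_sq_le_sq (by nlinarith [sq_nonneg Bl]) hT)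
  have hX : C ^ 2 / (m + 2) ≤ C ^ 2 / (m + 1) := by
    apply div_le_div_of_nonneg_left <;> first | positivity | linarith
  apply Real.sqrt_le_iff.mpr
  refine ⟨by positivity, ?_⟩
  have k1 : u * v ≤ T * (s * D) := mul_le_mul huT hvs hv0 hT
  have k2 : v ^ 2 ≤ (s * D) ^ 2 := pow_le_pow_left₀ hv0 hvs 2
  nlinarith
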